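/- Let s ≥ 1 be an integer and let F be a nonempty finite subset of ℤ^s. Define E = F ∩ (F−e_1) ∩ ⋯ ∩ (F−e_s), where (e_1,...,e_s) is the canonical basis of ℤ^s. Then |E| ≤ (1/s)|F| log|F|. -/

import Mathlib

theorem aux_log (a b : ℝ) (ha : 0 < a) (hb : 0 < b) (m : ℝ) (h1 : m ≤ a) (h2 : m ≤ b) :
    a * Real.log a + b * Real.log b + m ≤ (a + b) * Real.log (a + b) := by
  have key : ∀ x : ℝ, 0 < x → x - x * x / (a + b) ≤ x * Real.log (a + b) - x * Real.log x := by
    intro x hx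
    have h := Real.one_sub_inv_le_log_of_pos (x := (a + b) / x) (by positivity)
    rw [Real.log_div (by positivity) hx.ne', inv_div] at h
    have := mul_le_mul_of_nonneg_left h hx.le
    calc x - x * x / (a + b) = x * (1 - x / (a + b)) := by ring
      _ ≤ _ := this
      _ = _ := by ring
  have ka := key a ha
  have kb := key b hb
  have hm : m ≤ a - a * a / (a + b) + (b - b * b / (a + b)) := by
    have : a - a * a / (a + b) + (b - b * b / (a + b)) = 2 * a * b / (a + b) := by
      field_simp
      ring
    rw [this, le_div_iff₀ (by positivity)]
    nlinarith
  linarith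

theorem aux_edges (s : ℕ) (n : ℕ) : ∀ F : Finset (Fin s → ℤ), F.card = n →
    ((∑ i : Fin s, (F.filter fun x => x + Pi.single i 1 ∈ F).card : ℕ) : ℝ) ≤
      (F.card : ℝ) * Real.log (F.card : ℝ) := by
  induction n using Nat.strong_induction_on with
  | _ n ih =>
  intro F hn
  by_cases hsub : ∀ x ∈ F, ∀ y ∈ F, x = y
  · have h0 : (∑ i : Fin s, (F.filter fun x => x + Pi.single i 1 ∈ F).card) = 0 := by
      apply Finset.sum_eq_zero
      intro i _
      rw [Finset.card_eq_zero, Finset.filter_eq_empty_iff]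
      intro x hx hx'
      have := congrFun (hsub x hx _ hx') i
      simp at this
    rw [h0]
    have := Real.log_natCast_nonneg F.card
    push_cast
    positivity
  · push Not at hsub
    obtain ⟨x, hx, y, hy, hxy⟩ := hsub
    obtain ⟨i, hi⟩ : ∃ i, x i ≠ y i := by
      by_contra! h
      exact hxy (funext h)
    wlog hlt : x i < y i generalizing x y
    · exact this y hy x hx hxy.symm hi.symm (by omega)
    set A := F.filter fun z => z i ≤ x i with hA
    set B := F.filter fun z => ¬ z i ≤ x i with hB
    have hcard : A.card + B.card = F.card := Finset.card_filter_add_card_filter_not _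
    have hApos : 0 < A.card := Finset.card_pos.2 ⟨x, by simp [hA, hx]⟩
    have hBpos : 0 < B.card := Finset.card_pos.2 ⟨y, by simp [hB, hy, hlt]⟩
    have iA := ih A.card (by omega) A rfl
    have iB := ih B.card (by omega) B rfl
    set C := A.filter fun z => z + Pi.single i 1 ∈ B with hC
    have hCA : C.card ≤ A.card := Finset.card_filter_le _ _
    have hCB : C.card ≤ B.card := by
      apply Finset.card_le_card_of_injOn (fun z => z + Pi.single i 1)
      · intro z hz
        exact (Finset.mem_filter.1 hz).2
      · intro z _ w _ h
        exact add_right_cancel h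
    have hsum : (∑ j : Fin s, (F.filter fun x => x + Pi.single j 1 ∈ F).card) ≤
        (∑ j : Fin s, (A.filter fun x => x + Pi.single j 1 ∈ A).card) +
        (∑ j : Fin s, (B.filter fun x => x + Pi.single j 1 ∈ B).card) + C.card := by
      have : C.card = ∑ j : Fin s, if j = i then C.card else 0 := by simp
      rw [this, ← Finset.sum_add_distrib, ← Finset.sum_add_distrib]
      apply Finset.sum_le_sum
      intro j _
      have hsubs : (F.filter fun x => x + Pi.single j 1 ∈ F) ⊆
          ((A.filter fun x => x + Pi.single j 1 ∈ A) ∪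
          (B.filter fun x => x + Pi.single j 1 ∈ B)) ∪ (if j = i then C else ∅) := by
        intro z hz
        obtain ⟨hz1, hz2⟩ := Finset.mem_filter.1 hz
        by_cases hji : j = i
        · subst hji
          simp only [hC, hA, hB, Finset.mem_union, Finset.mem_filter, if_true, Pi.add_apply,
            Pi.single_eq_same, hz1, hz2, true_and]
          omega
        · have : (Pi.single j 1 : Fin s → ℤ) i = 0 := Pi.single_eq_of_ne (Ne.symm hji) _
          simp only [hA, hB, Finset.mem_union, Finset.mem_filter, if_neg hji, Pi.add_apply,
            this, hz1, hz2, true_and]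
          simp
          omega
      refine (Finset.card_le_card hsubs).trans ((Finset.card_union_le _ _).trans ?_)
      refine add_le_add (Finset.card_union_le _ _) ?_
      split_ifs <;> simp
    have hfin := aux_log A.card B.card (by exact_mod_cast hApos) (by exact_mod_cast hBpos) C.card
      (by exact_mod_cast hCA) (by exact_mod_cast hCB)
    have hsum' := (Nat.cast_le (α := ℝ)).2 hsum
    rw [Nat.cast_add, Nat.cast_add] at hsum'
    rw [← hcard, Nat.cast_add]
    linarith

theorem stmt_12 (s : ℕ) (hs : 1 ≤ s) (F : Finset (Fin s → ℤ)) (hF : F.Nonempty) :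
    (((F.filter fun x => ∀ i : Fin s, x + Pi.single i 1 ∈ F).card : ℝ)) ≤
      (1 / (s : ℝ)) * (F.card : ℝ) * Real.log (F.card : ℝ) := by
  have h := aux_edges s _ F rfl
  have h2 : s * (F.filter fun x => ∀ i : Fin s, x + Pi.single i 1 ∈ F).card ≤
      ∑ i : Fin s, (F.filter fun x => x + Pi.single i 1 ∈ F).card := by
    have := Finset.card_nsmul_le_sum (Finset.univ : Finset (Fin s))
      (fun i => (F.filter fun x => x + Pi.single i 1 ∈ F).card)
      (F.filter fun x => ∀ i : Fin s, x + Pi.single i 1 ∈ F).card (by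
        intro i _
        apply Finset.card_le_card
        intro z hz
        obtain ⟨hz1, hz2⟩ := Finset.mem_filter.1 hz
        exact Finset.mem_filter.2 ⟨hz1, hz2 i⟩)
    simpa using this
  have h3 := (Nat.cast_le (α := ℝ)).2 h2
  rw [Nat.cast_mul] at h3
  have hs' : (0 : ℝ) < s := by exact_mod_cast hs
  rw [mul_assoc, one_div, inv_mul_eq_div, le_div_iff₀ hs']
  linarith
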